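/- Suppose (A0), (B1), (B2) hold and the hitting probabilities of (X(t)) are slowly varying along every u ∈ E. Then every harmonic function h of (X(t)) satisfies h(x) = h(e) + 𝔼_x[h(H_1)] for all x ∈ E; hence h is superharmonic for the ladder height chain (H_n) with (I − P_H)h ≡ h(e), and h = h(e)·V + h̃, where h̃(x) = lim_{n→∞} 𝔼_x[ h(H_n) ; 𝒯_ϑ > n ] is harmonic for (H_n). Moreover, if 𝔼_·(τ_ϑ) = +∞ then h̃ = 0 and h is proportional to V. -/

import Mathlib

open scoped ENNReal Classical BigOperators
open Filter

noncomputable section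

namespace RW

variable {G : Type*}

/-- One-step transition operator `Pφ(x) = Σ_y p(x,y) φ(y)`. -/
def kapp (p : G → G → ℝ≥0∞) (φ : G → ℝ≥0∞) (x : G) : ℝ≥0∞ := ∑' y, p x y * φ y

/-- n-step transition kernel. -/
def kiter (p : G → G → ℝ≥0∞) : ℕ → G → G → ℝ≥0∞
  | 0 => fun x y => if x = y then 1 else 0
  | n + 1 => fun x y => ∑' z, p x z * kiter p n z y

/-- Green function `G(x,y) = Σ_t ℙ_x(X(t)=y)`. -/
def green (p : G → G → ℝ≥0∞) (x y : G) : ℝ≥0∞ := ∑' n, kiter p n x y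

/-- Green operator `Gφ(x) = Σ_y G(x,y) φ(y)`. -/
def greenApp (p : G → G → ℝ≥0∞) (φ : G → ℝ≥0∞) (x : G) : ℝ≥0∞ := ∑' y, green p x y * φ y

/-- Probability of first hitting `y` at time `n ≥ 1`. -/
def fhit (p : G → G → ℝ≥0∞) : ℕ → G → G → ℝ≥0∞
  | 0 => fun _ _ => 0
  | 1 => p
  | n + 2 => fun x y => ∑' z, if z = y then 0 else p x z * fhit p (n + 1) z y

/-- Hitting probability `Q(x,y) = ℙ_x(∃ t ≥ 1, X(t) = y)`. -/
def hitProb (p : G → G → ℝ≥0∞) (x y : G) : ℝ≥0∞ := ∑' n, fhit p n x y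

/-- Survival probability `ℙ_x(τ_ϑ > n)`. -/
def surv (p : G → G → ℝ≥0∞) (n : ℕ) (x : G) : ℝ≥0∞ := ∑' y, kiter p n x y

/-- Expected lifetime `𝔼_x(τ_ϑ) = Σ_n ℙ_x(τ_ϑ > n)`. -/
def gexp (p : G → G → ℝ≥0∞) (x : G) : ℝ≥0∞ := ∑' n, surv p n x

variable [Group G]

/-- Matrix coefficients `a_u(x,y)` of the operator `A_u = T_u P - P T_u`. -/
def acoef (p : G → G → ℝ≥0∞) (E : Set G) (u x y : G) : ℝ≥0∞ :=
  if y * u⁻¹ ∈ E then p (x * u) y - p x (y * u⁻¹) else p (x * u) y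

/-- The operator `A_u φ(x) = Σ_y a_u(x,y) φ(y)`. -/
def Aop (p : G → G → ℝ≥0∞) (E : Set G) (u : G) (φ : G → ℝ≥0∞) (x : G) : ℝ≥0∞ :=
  ∑' y, acoef p E u x y * φ y

/-- Ladder height transition kernel `p_H(x,y) = G A_x 𝟙_{y}(e)`. -/
def ladder (p : G → G → ℝ≥0∞) (E : Set G) (x y : G) : ℝ≥0∞ :=
  ∑' z, green p 1 z * acoef p E x z y

/-- The renewal function `V(x) = 𝔼_x(𝒯_ϑ)` of the ladder height process. -/
def V (p : G → G → ℝ≥0∞) (E : Set G) (x : G) : ℝ≥0∞ :=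
  ∑' n, surv (ladder p E) n x

end RW

end

open RW

namespace RW

section Kernel

variable {α : Type*}

theorem tsum_iSup_of_monotone {f : ℕ → α → ℝ≥0∞} (hf : Monotone f) :
    ∑' y, ⨆ n, f n y = ⨆ n, ∑' y, f n y := by
  let _ : MeasurableSpace α := ⊤
  simp_rw [← MeasureTheory.lintegral_count]
  exact MeasureTheory.lintegral_iSup (fun _ => measurable_from_top) hf

theorem tsum_iInf_of_antitone {f : ℕ → α → ℝ≥0∞} (hf : Antitone f)
    (h0 : ∑' y, f 0 y ≠ ⊤) : ∑' y, ⨅ n, f n y = ⨅ n, ∑' y, f n y := by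
  let _ : MeasurableSpace α := ⊤
  simp_rw [← MeasureTheory.lintegral_count] at h0 ⊢
  exact MeasureTheory.lintegral_iInf (fun _ => measurable_from_top) hf h0

theorem iSup_mul_iSup_of_monotone {a b : ℕ → ℝ≥0∞} (ha : Monotone a) (hb : Monotone b) :
    (⨆ n, a n) * ⨆ n, b n = ⨆ n, a n * b n := by
  refine le_antisymm ?_ (iSup_le fun n => mul_le_mul' (le_iSup a n) (le_iSup b n))
  rw [ENNReal.iSup_mul]
  refine iSup_le fun i => ?_
  rw [ENNReal.mul_iSup]
  refine iSup_le fun j => ?_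
  exact (mul_le_mul' (ha (le_max_left i j)) (hb (le_max_right i j))).trans
    (le_iSup (fun n => a n * b n) (max i j))

theorem kapp_mono {p q : α → α → ℝ≥0∞} {φ ψ : α → ℝ≥0∞} (hpq : p ≤ q) (h : φ ≤ ψ) :
    kapp p φ ≤ kapp q ψ :=
  fun x => ENNReal.tsum_le_tsum fun y => mul_le_mul' (hpq x y) (h y)

theorem kapp_add (p : α → α → ℝ≥0∞) (φ ψ : α → ℝ≥0∞) :
    kapp p (φ + ψ) = kapp p φ + kapp p ψ := by
  funext x
  simp only [kapp, Pi.add_apply, mul_add, ENNReal.tsum_add]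

theorem kapp_const_mul (p : α → α → ℝ≥0∞) (c : ℝ≥0∞) (φ : α → ℝ≥0∞) :
    kapp p (fun y => c * φ y) = fun x => c * kapp p φ x := by
  funext x
  simp only [kapp, ← ENNReal.tsum_mul_left]
  exact tsum_congr fun y => by ring

theorem kapp_congr {p : α → α → ℝ≥0∞} {E : Set α} {x : α} (hp : ∀ y ∉ E, p x y = 0)
    {φ ψ : α → ℝ≥0∞} (h : ∀ y ∈ E, φ y = ψ y) : kapp p φ x = kapp p ψ x := by
  refine tsum_congr fun y => ?_
  by_cases hy : y ∈ E
  · rw [h y hy]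
  · rw [hp y hy, zero_mul, zero_mul]

theorem kapp_le_of_le_on {p : α → α → ℝ≥0∞} {E : Set α} {x : α} (hp : ∀ y ∉ E, p x y = 0)
    {φ ψ : α → ℝ≥0∞} (h : ∀ y ∈ E, φ y ≤ ψ y) : kapp p φ x ≤ kapp p ψ x := by
  refine ENNReal.tsum_le_tsum fun y => ?_
  by_cases hy : y ∈ E
  · exact mul_le_mul' le_rfl (h y hy)
  · rw [hp y hy, zero_mul, zero_mul]

theorem kapp_kiter (p : α → α → ℝ≥0∞) (n : ℕ) (φ : α → ℝ≥0∞) :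
    kapp (kiter p n) φ = (kapp p)^[n] φ := by
  induction n with
  | zero =>
    funext x
    rw [kapp, tsum_eq_single x]
    · simp [kiter]
    · intro y hy
      simp [kiter, Ne.symm hy]
  | succ n ih =>
    rw [Function.iterate_succ_apply', ← ih]
    funext x
    simp only [kapp, kiter, ← ENNReal.tsum_mul_right, ← ENNReal.tsum_mul_left]
    rw [ENNReal.tsum_comm]
    exact tsum_congr fun z => tsum_congr fun y => by ring

theorem surv_eq_iterate (p : α → α → ℝ≥0∞) (n : ℕ) :
    surv p n = (kapp p)^[n] 1 := by
  rw [← kapp_kiter]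
  funext x
  simp [surv, kapp]

theorem surv_zero (p : α → α → ℝ≥0∞) (x : α) : surv p 0 x = 1 := by
  rw [surv_eq_iterate]; rfl

theorem surv_succ (p : α → α → ℝ≥0∞) (n : ℕ) : surv p (n + 1) = kapp p (surv p n) := by
  rw [surv_eq_iterate, surv_eq_iterate, Function.iterate_succ_apply']

theorem greenApp_eq_tsum (p : α → α → ℝ≥0∞) (φ : α → ℝ≥0∞) (x : α) :
    greenApp p φ x = ∑' n, (kapp p)^[n] φ x := by
  simp only [← kapp_kiter, greenApp, green, kapp, ← ENNReal.tsum_mul_right]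
  rw [ENNReal.tsum_comm]

theorem iterate_kapp_mono (p : α → α → ℝ≥0∞) (n : ℕ) : Monotone (kapp p)^[n] :=
  Monotone.iterate (fun _ _ h => kapp_mono le_rfl h) n

theorem iterate_kapp_add (p : α → α → ℝ≥0∞) (n : ℕ) (φ ψ : α → ℝ≥0∞) :
    (kapp p)^[n] (φ + ψ) = (kapp p)^[n] φ + (kapp p)^[n] ψ := by
  induction n generalizing φ ψ with
  | zero => rfl
  | succ n ih => simp only [Function.iterate_succ_apply, kapp_add, ih]

theorem iterate_kapp_const_mul (p : α → α → ℝ≥0∞) (n : ℕ) (c : ℝ≥0∞) (φ : α → ℝ≥0∞) :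
    (kapp p)^[n] (fun y => c * φ y) = fun x => c * (kapp p)^[n] φ x := by
  induction n generalizing φ with
  | zero => rfl
  | succ n ih => simp only [Function.iterate_succ_apply, kapp_const_mul, ih]

theorem iterate_kapp_antitone {p : α → α → ℝ≥0∞} {φ : α → ℝ≥0∞} (h : kapp p φ ≤ φ) :
    Antitone fun n => (kapp p)^[n] φ :=
  antitone_nat_of_succ_le fun n => by
    rw [Function.iterate_succ_apply]
    exact iterate_kapp_mono p n h

theorem kapp_iInf {p : α → α → ℝ≥0∞} {f : ℕ → α → ℝ≥0∞} (hf : Antitone f) {x : α}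
    (h0 : kapp p (f 0) x ≠ ⊤) :
    kapp p (fun y => ⨅ n, f n y) x = ⨅ n, kapp p (f n) x := by
  have key : ∀ y, p x y * ⨅ n, f n y = ⨅ n, p x y * f n y := by
    intro y
    refine ENNReal.mul_iInf fun htop _ => ⟨0, ?_⟩
    by_contra hne
    refine ENNReal.ne_top_of_tsum_ne_top h0 y ?_
    rw [htop, ENNReal.top_mul hne]
  simp only [kapp, key]
  exact tsum_iInf_of_antitone (fun m n hmn y => mul_le_mul' le_rfl (hf hmn y)) h0

theorem kapp_iInf_iterate {p : α → α → ℝ≥0∞} {φ : α → ℝ≥0∞} (h : kapp p φ ≤ φ) {x : α}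
    (hx : kapp p φ x ≠ ⊤) :
    kapp p (fun y => ⨅ n, (kapp p)^[n] φ y) x = ⨅ n, (kapp p)^[n] φ x := by
  have ha := iterate_kapp_antitone h
  rw [kapp_iInf ha hx]
  refine le_antisymm (le_iInf fun n => ?_) (le_iInf fun n => ?_)
  · refine (iInf_le _ n).trans ?_
    rw [← Function.iterate_succ_apply' (kapp p) n φ]
    exact ha n.le_succ x
  · refine (iInf_le _ (n + 1)).trans ?_
    rw [Function.iterate_succ_apply' (kapp p) n φ]

theorem kapp_iSup {p : ℕ → α → α → ℝ≥0∞} {f : ℕ → α → ℝ≥0∞} (hp : Monotone p)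
    (hf : Monotone f) (x : α) :
    kapp (fun x y => ⨆ n, p n x y) (fun y => ⨆ n, f n y) x = ⨆ n, kapp (p n) (f n) x := by
  simp only [kapp]
  rw [← tsum_iSup_of_monotone (fun m n hmn y => mul_le_mul' (hp hmn x y) (hf hmn y))]
  exact tsum_congr fun y => iSup_mul_iSup_of_monotone (fun m n h => hp h x y) (fun m n h => hf h y)

theorem surv_mono {p q : α → α → ℝ≥0∞} (h : p ≤ q) (n : ℕ) : surv p n ≤ surv q n := by
  induction n with
  | zero => intro x; rw [surv_zero, surv_zero]
  | succ n ih => rw [surv_succ, surv_succ]; exact kapp_mono h ih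

theorem surv_iSup {p : ℕ → α → α → ℝ≥0∞} (hp : Monotone p) (k : ℕ) (x : α) :
    surv (fun x y => ⨆ n, p n x y) k x = ⨆ n, surv (p n) k x := by
  induction k generalizing x with
  | zero => simp [surv_zero]
  | succ k ih =>
    simp only [surv_succ]
    rw [← kapp_iSup hp (fun m n h => surv_mono (hp h) k)]
    congr 1
    exact funext ih

theorem gexp_eq (p : α → α → ℝ≥0∞) (x : α) : gexp p x = 1 + kapp p (gexp p) x := by
  have : kapp p (gexp p) x = ∑' n, surv p (n + 1) x := by
    simp only [surv_succ, kapp, gexp, ← ENNReal.tsum_mul_left]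
    rw [ENNReal.tsum_comm]
  rw [this, gexp, tsum_eq_zero_add' ENNReal.summable, surv_zero]

/-- Iterating `f = c + P f` on a set outside of which the kernel vanishes. -/
theorem eq_sum_surv_add_iterate {q : α → α → ℝ≥0∞} {E : Set α} (hq : ∀ x, ∀ y ∉ E, q x y = 0)
    {f : α → ℝ≥0∞} {c : ℝ≥0∞} (hf : ∀ x ∈ E, f x = c + kapp q f x) (n : ℕ) :
    ∀ x ∈ E, f x = c * ∑ k ∈ Finset.range n, surv q k x + (kapp q)^[n] f x := by
  induction n with
  | zero => intro x _; simp
  | succ n ih =>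
    intro x hx
    rw [hf x hx, kapp_congr (hq x) ih]
    have : (fun y => c * ∑ k ∈ Finset.range n, surv q k y + (kapp q)^[n] f y) =
        (fun y => c * (∑ k ∈ Finset.range n, surv q k) y) + (kapp q)^[n] f := by
      funext y; simp [Finset.sum_apply]
    have hsum : kapp q (∑ k ∈ Finset.range n, surv q k) x =
        ∑ k ∈ Finset.range n, surv q (k + 1) x := by
      simp only [kapp, surv_succ, Finset.sum_apply, Finset.mul_sum]
      rw [Summable.tsum_finsetSum fun _ _ => ENNReal.summable]
    rw [this, kapp_add, kapp_const_mul, Pi.add_apply, hsum, Finset.sum_range_succ',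
      surv_zero, Function.iterate_succ_apply']
    ring

/-- The minimum principle: an excessive function dominates its values weighted by hitting
probabilities. -/
theorem hitProb_mul_le {p : α → α → ℝ≥0∞} {E : Set α} (hp : ∀ x, ∀ y ∉ E, p x y = 0)
    {f : α → ℝ≥0∞} (hf : ∀ x ∈ E, kapp p f x ≤ f x) {x : α} (hx : x ∈ E) (y : α) :
    hitProb p x y * f y ≤ f x := by
  have key : ∀ n, ∀ x ∈ E, (∑ k ∈ Finset.range n, fhit p (k + 1) x y) * f y ≤ f x := by
    intro n
    induction n with
    | zero => simp
    | succ n ih =>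
      intro x hx
      refine le_trans ?_ (hf x hx)
      have hsum : ∑ k ∈ Finset.range n, fhit p (k + 2) x y =
          ∑' z, if z = y then 0 else p x z * ∑ k ∈ Finset.range n, fhit p (k + 1) z y := by
        simp only [fhit]
        rw [← Summable.tsum_finsetSum fun _ _ => ENNReal.summable]
        refine tsum_congr fun z => ?_
        split_ifs <;> simp [Finset.mul_sum]
      have hkapp : kapp p f x = p x y * f y + ∑' z, if z = y then 0 else p x z * f z :=
        ENNReal.tsum_eq_add_tsum_ite y
      rw [Finset.sum_range_succ', hsum, add_mul, hkapp, add_comm]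
      refine add_le_add (le_refl (p x y * f y)) ?_
      rw [← ENNReal.tsum_mul_right]
      refine ENNReal.tsum_le_tsum fun z => ?_
      split_ifs with h
      · simp
      · by_cases hz : z ∈ E
        · rw [mul_assoc]
          exact mul_le_mul' le_rfl (ih z hz)
        · simp [hp x z hz]
  rw [hitProb, tsum_eq_zero_add' ENNReal.summable]
  simp only [fhit, zero_add]
  rw [← ENNReal.tsum_mul_right, ENNReal.tsum_eq_iSup_nat]
  refine iSup_le fun n => ?_
  rw [← Finset.sum_mul]
  exact key n x hx

theorem hitProb_le_one {p : α → α → ℝ≥0∞} {E : Set α} (hp : ∀ x, ∀ y ∉ E, p x y = 0)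
    (hsub : ∀ x, (∑' y, p x y) ≤ 1) {x : α} (hx : x ∈ E) (y : α) : hitProb p x y ≤ 1 := by
  simpa using hitProb_mul_le hp (f := 1) (fun x _ => by simpa [kapp] using hsub x) hx y

end Kernel

section ConeOperator

variable {α : Type*}

/-- An additive, positively homogeneous operator on a cone of finite nonnegative functions which
is stable under differences. -/
structure IsConeOperator (K : Set (α → ℝ≥0∞)) (Λ : (α → ℝ≥0∞) → α → ℝ≥0∞) : Prop where
  ne_top : ∀ f ∈ K, ∀ x, f x ≠ ⊤
  smul_mem : ∀ c : ℝ≥0∞, c ≠ ⊤ → ∀ f ∈ K, (fun x => c * f x) ∈ K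
  exists_sub : ∀ f ∈ K, ∀ g ∈ K, f ≤ g → ∃ d ∈ K, g = f + d
  map_mem : ∀ f ∈ K, Λ f ∈ K
  map_add : ∀ f ∈ K, ∀ g ∈ K, Λ (f + g) = Λ f + Λ g
  map_smul : ∀ c : ℝ≥0∞, c ≠ ⊤ → ∀ f ∈ K, Λ (fun x => c * f x) = fun x => c * Λ f x

namespace IsConeOperator

variable {K : Set (α → ℝ≥0∞)} {Λ : (α → ℝ≥0∞) → α → ℝ≥0∞}

theorem iterate (hΛ : IsConeOperator K Λ) (n : ℕ) : IsConeOperator K Λ^[n] := by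
  induction n with
  | zero => exact ⟨hΛ.ne_top, hΛ.smul_mem, hΛ.exists_sub, fun _ h => h, fun _ _ _ _ => rfl,
      fun _ _ _ _ => rfl⟩
  | succ n ih =>
    refine ⟨hΛ.ne_top, hΛ.smul_mem, hΛ.exists_sub, ?_, ?_, ?_⟩
    · intro f hf
      exact ih.map_mem _ (hΛ.map_mem f hf)
    · intro f hf g hg
      simp only [Function.iterate_succ_apply]
      rw [hΛ.map_add f hf g hg, ih.map_add _ (hΛ.map_mem f hf) _ (hΛ.map_mem g hg)]
    · intro c hc f hf
      simp only [Function.iterate_succ_apply]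
      rw [hΛ.map_smul c hc f hf, ih.map_smul c hc _ (hΛ.map_mem f hf)]

theorem exists_sub_toReal (hΛ : IsConeOperator K Λ) {f g : α → ℝ≥0∞} (hf : f ∈ K) (hg : g ∈ K)
    {a : ℝ} (ha : 0 ≤ a) (h : ∀ x, (g x).toReal ≤ a * (f x).toReal) :
    ∃ d ∈ K, ∀ x, (d x).toReal = a * (f x).toReal - (g x).toReal ∧
      (Λ d x).toReal = a * (Λ f x).toReal - (Λ g x).toReal := by
  have hle : g ≤ fun x => ENNReal.ofReal a * f x := by
    intro x
    rw [← ENNReal.toReal_le_toReal (hΛ.ne_top g hg x)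
      (ENNReal.mul_ne_top ENNReal.ofReal_ne_top (hΛ.ne_top f hf x)), ENNReal.toReal_mul,
      ENNReal.toReal_ofReal ha]
    exact h x
  obtain ⟨d, hd, hgd⟩ := hΛ.exists_sub g hg _
    (hΛ.smul_mem _ ENNReal.ofReal_ne_top f hf) hle
  refine ⟨d, hd, fun x => ⟨?_, ?_⟩⟩
  · have := congrArg ENNReal.toReal (congrFun hgd x)
    rw [Pi.add_apply, ENNReal.toReal_add (hΛ.ne_top g hg x) (hΛ.ne_top d hd x),
      ENNReal.toReal_mul, ENNReal.toReal_ofReal ha] at this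
    linarith
  · have h1 := congrArg Λ hgd
    rw [hΛ.map_add g hg d hd, hΛ.map_smul _ ENNReal.ofReal_ne_top f hf] at h1
    have := congrArg ENNReal.toReal (congrFun h1 x)
    rw [Pi.add_apply, ENNReal.toReal_add (hΛ.ne_top _ (hΛ.map_mem g hg) x)
      (hΛ.ne_top _ (hΛ.map_mem d hd) x), ENNReal.toReal_mul, ENNReal.toReal_ofReal ha] at this
    linarith

/-- An upper bound for the square of a cone operator gives one for the operator itself. -/
theorem le_of_sq_le (hΛ : IsConeOperator K Λ) {C b : ℝ} (hC : 0 ≤ C) (hb : 0 ≤ b)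
    (hbd : ∀ f ∈ K, ∀ x, (Λ f x).toReal ≤ C * (f x).toReal)
    (hsq : ∀ f ∈ K, ∀ x, (Λ (Λ f) x).toReal ≤ b ^ 2 * (f x).toReal) :
    ∀ f ∈ K, ∀ x, (Λ f x).toReal ≤ b * (f x).toReal := by
  set S : Set ℝ := {a | 0 ≤ a ∧ ∀ f ∈ K, ∀ x, (Λ f x).toReal ≤ a * (f x).toReal} with hS
  have hclosed : IsClosed S := by
    simp only [hS, Set.ofPred_and, Set.ofPred_forall]
    refine isClosed_Ici.inter ?_
    exact isClosed_iInter fun f => isClosed_iInter fun _ => isClosed_iInter fun x =>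
      isClosed_le continuous_const (continuous_id.mul continuous_const)
  have hbdd : BddBelow S := ⟨0, fun a ha => ha.1⟩
  have hmem : sInf S ∈ S := hclosed.csInf_mem ⟨C, hC, hbd⟩ hbdd
  set a := sInf S with ha_def
  have hab : a ≤ b := by
    rcases hmem.1.eq_or_lt with h0 | hpos
    · rwa [← h0]
    · have hnew : (a ^ 2 + b ^ 2) / (2 * a) ∈ S := by
        refine ⟨by positivity, fun f hf x => ?_⟩
        obtain ⟨d, hd, hdx⟩ := hΛ.exists_sub_toReal hf (hΛ.map_mem f hf) hmem.1 (hmem.2 f hf)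
        have h1 := hmem.2 d hd x
        rw [(hdx x).1, (hdx x).2] at h1
        have h2 := hsq f hf x
        rw [div_mul_eq_mul_div, le_div_iff₀ (by positivity)]
        linarith
      have h3 : a ≤ (a ^ 2 + b ^ 2) / (2 * a) := csInf_le hbdd hnew
      rw [le_div_iff₀ (by positivity)] at h3
      exact le_of_sq_le_sq (by nlinarith) hb
  exact fun f hf x => (hmem.2 f hf x).trans
    (mul_le_mul_of_nonneg_right hab ENNReal.toReal_nonneg)

/-- A lower bound for the square of a contractive cone operator gives one for the operator. -/
theorem ge_of_sq_ge (hΛ : IsConeOperator K Λ) {b : ℝ} (hb : 0 ≤ b) (hb1 : b ≤ 1)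
    (hbd : ∀ f ∈ K, ∀ x, (Λ f x).toReal ≤ (f x).toReal)
    (hsq : ∀ f ∈ K, ∀ x, b ^ 2 * (f x).toReal ≤ (Λ (Λ f) x).toReal) :
    ∀ f ∈ K, ∀ x, b * (f x).toReal ≤ (Λ f x).toReal := by
  set S : Set ℝ := {c | (0 ≤ c ∧ c ≤ 1) ∧ ∀ f ∈ K, ∀ x, c * (f x).toReal ≤ (Λ f x).toReal}
    with hS
  have hclosed : IsClosed S := by
    simp only [hS, Set.ofPred_and, Set.ofPred_forall]
    refine (isClosed_Ici.inter isClosed_Iic).inter ?_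
    exact isClosed_iInter fun f => isClosed_iInter fun _ => isClosed_iInter fun x =>
      isClosed_le (continuous_id.mul continuous_const) continuous_const
  have hbdd : BddAbove S := ⟨1, fun a ha => ha.1.2⟩
  have hmem : sSup S ∈ S := hclosed.csSup_mem
    ⟨0, ⟨le_rfl, zero_le_one⟩, fun f _ x => by simp⟩ hbdd
  set c := sSup S with hc_def
  have hc0 := hmem.1.1
  have hc1 := hmem.1.2
  have hbc : b ≤ c := by
    have hnew : (c + b ^ 2) / (1 + c) ∈ S := by
      refine ⟨⟨by positivity, ?_⟩, fun f hf x => ?_⟩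
      · rw [div_le_one (by positivity)]
        nlinarith
      · obtain ⟨d, hd, hdx⟩ := hΛ.exists_sub_toReal hf (hΛ.map_mem f hf) zero_le_one
          (fun x => by simpa using hbd f hf x)
        have h1 := hmem.2 d hd x
        rw [(hdx x).1, (hdx x).2] at h1
        have h2 := hsq f hf x
        rw [div_mul_eq_mul_div, div_le_iff₀ (by positivity)]
        linarith
    have h3 : (c + b ^ 2) / (1 + c) ≤ c := le_csSup hbdd hnew
    rw [div_le_iff₀ (by positivity)] at h3
    exact le_of_sq_le_sq (by nlinarith) hc0
  exact fun f hf x => (mul_le_mul_of_nonneg_right hbc ENNReal.toReal_nonneg).trans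
    (hmem.2 f hf x)

theorem le_of_iterate_le (hΛ : IsConeOperator K Λ) {C b : ℝ} (hC : 0 ≤ C) (hb : 0 ≤ b)
    (hbd : ∀ f ∈ K, ∀ x, (Λ f x).toReal ≤ C * (f x).toReal) (j : ℕ)
    (hj : ∀ f ∈ K, ∀ x, (Λ^[2 ^ j] f x).toReal ≤ b ^ 2 ^ j * (f x).toReal) :
    ∀ f ∈ K, ∀ x, (Λ f x).toReal ≤ b * (f x).toReal := by
  have hiter : ∀ n, ∀ f ∈ K, ∀ x, (Λ^[n] f x).toReal ≤ C ^ n * (f x).toReal := by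
    intro n
    induction n with
    | zero => simp
    | succ n ih =>
      intro f hf x
      rw [Function.iterate_succ_apply, pow_succ, mul_assoc]
      exact (ih _ (hΛ.map_mem f hf) x).trans
        (mul_le_mul_of_nonneg_left (hbd f hf x) (by positivity))
  induction j with
  | zero => simpa using hj
  | succ j ih =>
    refine ih ((hΛ.iterate (2 ^ j)).le_of_sq_le (pow_nonneg hC _) (pow_nonneg hb _)
      (hiter (2 ^ j)) fun f hf x => ?_)
    rw [← Function.iterate_add_apply, ← two_mul, ← pow_succ', ← pow_mul, ← pow_succ]
    exact hj f hf x

theorem ge_of_iterate_ge (hΛ : IsConeOperator K Λ) {b : ℝ} (hb : 0 ≤ b) (hb1 : b ≤ 1)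
    (hbd : ∀ f ∈ K, ∀ x, (Λ f x).toReal ≤ (f x).toReal) (j : ℕ)
    (hj : ∀ f ∈ K, ∀ x, b ^ 2 ^ j * (f x).toReal ≤ (Λ^[2 ^ j] f x).toReal) :
    ∀ f ∈ K, ∀ x, b * (f x).toReal ≤ (Λ f x).toReal := by
  have hiter : ∀ n, ∀ f ∈ K, ∀ x, (Λ^[n] f x).toReal ≤ (f x).toReal := by
    intro n
    induction n with
    | zero => simp
    | succ n ih =>
      intro f hf x
      rw [Function.iterate_succ_apply]
      exact (ih _ (hΛ.map_mem f hf) x).trans (hbd f hf x)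
  induction j with
  | zero => simpa using hj
  | succ j ih =>
    refine ih ((hΛ.iterate (2 ^ j)).ge_of_sq_ge (pow_nonneg hb _) (pow_le_one₀ hb hb1)
      (hiter (2 ^ j)) fun f hf x => ?_)
    rw [← Function.iterate_add_apply, ← two_mul, ← pow_succ', ← pow_mul, ← pow_succ]
    exact hj f hf x

/-- A bounded cone operator whose iterates grow and decay subexponentially is the identity. -/
theorem eq_self (hΛ : IsConeOperator K Λ) {C : ℝ} (hC : 0 ≤ C)
    (hbd : ∀ f ∈ K, ∀ x, (Λ f x).toReal ≤ C * (f x).toReal)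
    (hup : ∀ b : ℝ, 1 < b → ∀ᶠ n : ℕ in atTop, ∀ f ∈ K, ∀ x,
      (Λ^[n] f x).toReal ≤ b ^ n * (f x).toReal)
    (hlow : ∀ b : ℝ, 1 < b → ∀ᶠ n : ℕ in atTop, ∀ f ∈ K, ∀ x,
      (f x).toReal ≤ b ^ n * (Λ^[n] f x).toReal)
    {f : α → ℝ≥0∞} (hf : f ∈ K) : Λ f = f := by
  have hpow : Tendsto (fun j : ℕ => 2 ^ j) atTop atTop :=
    tendsto_pow_atTop_atTop_of_one_lt one_lt_two
  have hle : ∀ f ∈ K, ∀ x, (Λ f x).toReal ≤ (f x).toReal := by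
    have h1 : ∀ b : ℝ, 1 < b → ∀ f ∈ K, ∀ x, (Λ f x).toReal ≤ b * (f x).toReal := by
      intro b hb
      obtain ⟨j, hj⟩ := (hpow.eventually (hup b hb)).exists
      exact hΛ.le_of_iterate_le hC (by linarith) hbd j hj
    intro f hf x
    have ht : Tendsto (fun b : ℝ => b * (f x).toReal) (nhdsWithin 1 (Set.Ioi 1))
        (nhds (1 * (f x).toReal)) :=
      tendsto_nhdsWithin_of_tendsto_nhds (tendsto_id.mul_const _)
    rw [one_mul] at ht
    exact ge_of_tendsto ht (eventually_mem_nhdsWithin.mono fun b hb => h1 b hb f hf x)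
  have hge : ∀ b : ℝ, 1 < b → ∀ f ∈ K, ∀ x, (f x).toReal ≤ b * (Λ f x).toReal := by
    intro b hb f hf x
    have hb0 : 0 < b := by linarith
    obtain ⟨j, hj⟩ := (hpow.eventually (hlow b hb)).exists
    have := hΛ.ge_of_iterate_ge (b := b⁻¹) (by positivity) (inv_le_one_of_one_le₀ hb.le) hle j
      (fun f hf x => by
        rw [inv_pow, inv_mul_le_iff₀ (by positivity)]
        exact hj f hf x) f hf x
    rwa [inv_mul_le_iff₀ hb0] at this
  funext x
  refine (ENNReal.toReal_eq_toReal_iff' (hΛ.ne_top _ (hΛ.map_mem f hf) x)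
    (hΛ.ne_top f hf x)).1 (le_antisymm (hle f hf x) ?_)
  have ht : Tendsto (fun b : ℝ => b * (Λ f x).toReal) (nhdsWithin 1 (Set.Ioi 1))
      (nhds (1 * (Λ f x).toReal)) :=
    tendsto_nhdsWithin_of_tendsto_nhds (tendsto_id.mul_const _)
  rw [one_mul] at ht
  exact ge_of_tendsto ht (eventually_mem_nhdsWithin.mono fun b hb => hge b hb f hf x)

end IsConeOperator

end ConeOperator

section HarmonicCone

variable {α : Type*}

/-- Finite nonnegative harmonic functions. -/
def harmonicCone (p : α → α → ℝ≥0∞) : Set (α → ℝ≥0∞) :=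
  {f | kapp p f = f ∧ ∀ x, f x ≠ ⊤}

theorem iterate_kapp_of_mem {p : α → α → ℝ≥0∞} {f : α → ℝ≥0∞} (hf : f ∈ harmonicCone p) (n : ℕ) :
    (kapp p)^[n] f = f :=
  Function.iterate_fixed hf.1 n

theorem eventually_one_le_pow_mul {E : Set α} {Q : ℕ → α → ℝ} (hQ : ∀ n, ∀ x ∈ E, 0 < Q n x)
    (h : TendstoUniformlyOn (fun (n : ℕ) x => Real.log (Q n x) / n) (fun _ => 0) atTop E)
    {b : ℝ} (hb : 1 < b) : ∀ᶠ n : ℕ in atTop, ∀ x ∈ E, 1 ≤ b ^ n * Q n x := by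
  have hlog : 0 < Real.log b := Real.log_pos hb
  filter_upwards [Metric.tendstoUniformlyOn_iff.1 h _ hlog, eventually_ge_atTop 1] with n hn hn1 x hx
  have hnpos : (0 : ℝ) < n := by exact_mod_cast hn1
  have hb0 : 0 < b := by linarith
  have h1 := hn x hx
  rw [Real.dist_eq, zero_sub, abs_neg, abs_lt] at h1
  have h2 := h1.1
  rw [lt_div_iff₀ hnpos] at h2
  have hq := hQ n x hx
  rw [← Real.log_nonneg_iff (by positivity), Real.log_mul (by positivity) hq.ne', Real.log_pow]
  linarith

end HarmonicCone

section Translation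

variable {G : Type*} [Group G]

/-- Limit of the iterates of the transition operator on a right translate. -/
noncomputable def translateLim (p : G → G → ℝ≥0∞) (u : G) (f : G → ℝ≥0∞) (x : G) : ℝ≥0∞ :=
  ⨅ n, (kapp p)^[n] (fun y => f (y * u)) x

variable {p : G → G → ℝ≥0∞} {E : Set G} {u : G}

theorem kapp_translate_le (hu : ∀ x y, p x y ≤ p (x * u) (y * u)) (f : G → ℝ≥0∞) :
    kapp p (fun y => f (y * u)) ≤ fun x => kapp p f (x * u) := by
  intro x
  calc kapp p (fun y => f (y * u)) x ≤ ∑' y, p (x * u) (y * u) * f (y * u) :=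
        ENNReal.tsum_le_tsum fun y => mul_le_mul' (hu x y) le_rfl
    _ = kapp p f (x * u) := (Equiv.mulRight u).tsum_eq fun y => p (x * u) y * f y

theorem iterate_kapp_translate_le (hu : ∀ x y, p x y ≤ p (x * u) (y * u)) (n : ℕ)
    (f : G → ℝ≥0∞) :
    (kapp p)^[n] (fun y => f (y * u)) ≤ fun x => (kapp p)^[n] f (x * u) := by
  induction n generalizing f with
  | zero => exact le_rfl
  | succ n ih =>
    simp only [Function.iterate_succ_apply]
    exact (iterate_kapp_mono p n (kapp_translate_le hu f)).trans (ih _)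

theorem kapp_translate_le_self (hu : ∀ x y, p x y ≤ p (x * u) (y * u)) {f : G → ℝ≥0∞}
    (hf : f ∈ harmonicCone p) : kapp p (fun y => f (y * u)) ≤ fun x => f (x * u) := by
  have := kapp_translate_le hu f
  rwa [hf.1] at this

theorem translateLim_le (f : G → ℝ≥0∞) (x : G) : translateLim p u f x ≤ f (x * u) :=
  iInf_le (fun n => (kapp p)^[n] (fun y => f (y * u)) x) 0

theorem translateLim_mem (hu : ∀ x y, p x y ≤ p (x * u) (y * u)) {f : G → ℝ≥0∞}
    (hf : f ∈ harmonicCone p) : translateLim p u f ∈ harmonicCone p := by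
  have hle := kapp_translate_le_self hu hf
  refine ⟨?_, fun x => ne_top_of_le_ne_top (hf.2 _) (translateLim_le f x)⟩
  funext x
  exact kapp_iInf_iterate hle (ne_top_of_le_ne_top (hf.2 _) (hle x))

theorem isConeOperator_translateLim (hu : ∀ x y, p x y ≤ p (x * u) (y * u)) :
    IsConeOperator (harmonicCone p) (translateLim p u) where
  ne_top f hf := hf.2
  smul_mem c hc f hf := by
    refine ⟨?_, fun x => ENNReal.mul_ne_top hc (hf.2 x)⟩
    rw [kapp_const_mul, hf.1]
  exists_sub f hf g hg hfg := by
    have hadd : g = f + fun x => g x - f x := by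
      funext x
      exact (add_tsub_cancel_of_le (hfg x)).symm
    refine ⟨fun x => g x - f x, ⟨?_, fun x => ENNReal.sub_ne_top (hg.2 x)⟩, hadd⟩
    have h1 := hg.1
    nth_rw 1 [hadd] at h1
    rw [kapp_add, hf.1] at h1
    funext x
    refine (ENNReal.add_right_inj (hf.2 x)).1 ?_
    exact (congrFun h1 x).trans (congrFun hadd x)
  map_mem f hf := translateLim_mem hu hf
  map_add f hf g hg := by
    funext x
    change ⨅ n, (kapp p)^[n] ((fun y => f (y * u)) + fun y => g (y * u)) x = _
    simp only [iterate_kapp_add, Pi.add_apply]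
    refine (ENNReal.iInf_add_iInf fun i j : ℕ => ⟨max i j, add_le_add ?_ ?_⟩).symm
    · exact iterate_kapp_antitone (kapp_translate_le_self hu hf) (le_max_left i j) x
    · exact iterate_kapp_antitone (kapp_translate_le_self hu hg) (le_max_right i j) x
  map_smul c hc f hf := by
    funext x
    simp only [translateLim]
    rw [ENNReal.mul_iInf fun h => absurd h hc]
    refine iInf_congr fun n => ?_
    exact congrFun (iterate_kapp_const_mul p n c fun y => f (y * u)) x

theorem translateLim_iterate_le (n : ℕ) (f : G → ℝ≥0∞) (x : G) :
    (translateLim p u)^[n] f x ≤ f (x * u ^ n) := by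
  induction n generalizing x with
  | zero => simp
  | succ n ih =>
    rw [Function.iterate_succ_apply', pow_succ', ← mul_assoc]
    exact (translateLim_le _ x).trans (ih _)

theorem le_translateLim_iterate (hu : ∀ x y, p x y ≤ p (x * u) (y * u)) (n : ℕ)
    {f g : G → ℝ≥0∞} (hf : f ∈ harmonicCone p) (hg : g ∈ harmonicCone p)
    (h : ∀ x, g x ≤ f (x * u ^ n)) : g ≤ (translateLim p u)^[n] f := by
  have hupow : ∀ n : ℕ, ∀ x y, p x y ≤ p (x * u ^ n) (y * u ^ n) := by
    intro n
    induction n with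
    | zero => simp
    | succ n ih =>
      intro x y
      rw [pow_succ, ← mul_assoc, ← mul_assoc]
      exact (ih x y).trans (hu _ _)
  induction n generalizing f with
  | zero => exact fun x => by simpa using h x
  | succ n ih =>
    rw [Function.iterate_succ_apply]
    refine ih (translateLim_mem hu hf) fun x => le_iInf fun k => ?_
    have h1 : g ≤ fun y => (fun z => f (z * u)) (y * u ^ n) := by
      intro y
      simpa [pow_succ, mul_assoc] using h y
    have h2 := iterate_kapp_mono p k h1
    rw [iterate_kapp_of_mem hg] at h2
    exact (h2 x).trans (iterate_kapp_translate_le (hupow n) k _ x)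

/-- Harmonic functions are invariant under translation followed by iteration of the transition
operator, provided they grow and decay uniformly subexponentially in the direction `u`. -/
theorem translateLim_eq_self (hp : ∀ x ∉ E, ∀ y, p x y = 0) (hu : ∀ x y, p x y ≤ p (x * u) (y * u))
    (huE : ∀ x ∈ E, x * u ∈ E)
    (hgrow : ∀ b : ℝ, 1 < b → ∀ᶠ n : ℕ in atTop, ∀ f ∈ harmonicCone p, ∀ x ∈ E,
      (f (x * u ^ n)).toReal ≤ b ^ n * (f x).toReal ∧
      (f x).toReal ≤ b ^ n * (f (x * u ^ n)).toReal)
    {f : G → ℝ≥0∞} (hf : f ∈ harmonicCone p) : translateLim p u f = f := by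
  have hΛ := isConeOperator_translateLim hu
  have hzero : ∀ f ∈ harmonicCone p, ∀ x ∉ E, f x = 0 := by
    intro f hf x hx
    rw [← hf.1]
    simp [kapp, hp x hx]
  obtain ⟨N, hN⟩ := eventually_atTop.1 (hgrow 2 one_lt_two)
  refine hΛ.eq_self (C := 2 ^ N * 2 ^ (N + 1)) (by positivity) ?_ ?_ ?_ hf
  · intro f hf x
    by_cases hx : x ∈ E
    · have h1 := (hN N le_rfl f hf (x * u) (huE x hx)).2
      have h2 := (hN (N + 1) N.le_succ f hf x hx).1
      have h3 : (translateLim p u f x).toReal ≤ (f (x * u)).toReal :=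
        ENNReal.toReal_mono (hf.2 _) (translateLim_le f x)
      rw [mul_assoc, ← pow_succ'] at h1
      refine h3.trans (h1.trans ?_)
      rw [mul_assoc]
      exact mul_le_mul_of_nonneg_left h2 (by positivity)
    · simp [hzero _ (hΛ.map_mem f hf) x hx, hzero f hf x hx]
  · intro b hb
    filter_upwards [hgrow b hb] with n hn f hf x
    by_cases hx : x ∈ E
    · exact (ENNReal.toReal_mono (hf.2 _) (translateLim_iterate_le n f x)).trans (hn f hf x hx).1
    · simp [hzero _ ((hΛ.iterate n).map_mem f hf) x hx, hzero f hf x hx]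
  · intro b hb
    filter_upwards [hgrow b hb] with n hn f hf x
    have hb0 : 0 < b ^ n := by positivity
    have hc : ENNReal.ofReal (b ^ n)⁻¹ ≠ ⊤ := ENNReal.ofReal_ne_top
    have hle := le_translateLim_iterate hu n hf (hΛ.smul_mem _ hc f hf) (fun y => by
      by_cases hy : y ∈ E
      · rw [← ENNReal.toReal_le_toReal (ENNReal.mul_ne_top hc (hf.2 _)) (hf.2 _),
          ENNReal.toReal_mul, ENNReal.toReal_ofReal (by positivity), inv_mul_le_iff₀ hb0]
        exact (hn f hf y hy).2
      · simp [hzero f hf y hy]) x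
    have := ENNReal.toReal_mono (((hΛ.iterate n).map_mem f hf).2 x) hle
    rwa [ENNReal.toReal_mul, ENNReal.toReal_ofReal (by positivity), inv_mul_le_iff₀ hb0] at this

theorem harmonicCone_grow (hp : ∀ x, ∀ y ∉ E, p x y = 0) (hsub : ∀ x, (∑' y, p x y) ≤ 1)
    (hirr : ∀ x ∈ E, ∀ y ∈ E, 0 < hitProb p x y) (hpow : ∀ x ∈ E, ∀ n : ℕ, x * u ^ n ∈ E)
    (hsv1 : TendstoUniformlyOn
      (fun (n : ℕ) (x : G) => Real.log ((hitProb p x (x * u ^ n)).toReal) / n)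
      (fun _ => 0) atTop E)
    (hsv2 : TendstoUniformlyOn
      (fun (n : ℕ) (x : G) => Real.log ((hitProb p (x * u ^ n) x).toReal) / n)
      (fun _ => 0) atTop E) (b : ℝ) (hb : 1 < b) :
    ∀ᶠ n : ℕ in atTop, ∀ f ∈ harmonicCone p, ∀ x ∈ E,
      (f (x * u ^ n)).toReal ≤ b ^ n * (f x).toReal ∧
      (f x).toReal ≤ b ^ n * (f (x * u ^ n)).toReal := by
  have hpos : ∀ x ∈ E, ∀ y ∈ E, 0 < (hitProb p x y).toReal := fun x hx y hy =>
    ENNReal.toReal_pos (hirr x hx y hy).ne'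
      (ne_top_of_le_ne_top ENNReal.one_ne_top (hitProb_le_one hp hsub hx y))
  have hharn : ∀ f ∈ harmonicCone p, ∀ x ∈ E, ∀ y,
      (hitProb p x y).toReal * (f y).toReal ≤ (f x).toReal := by
    intro f hf x hx y
    rw [← ENNReal.toReal_mul]
    exact ENNReal.toReal_mono (hf.2 x)
      (hitProb_mul_le hp (fun x _ => (congrFun hf.1 x).le) hx y)
  have hcomb : ∀ {c q s t : ℝ}, 0 ≤ c → 0 ≤ s → 1 ≤ c * q → q * s ≤ t → s ≤ c * t := by
    intro c q s t hc hs h1 h2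
    calc s ≤ (c * q) * s := le_mul_of_one_le_left hs h1
      _ = c * (q * s) := mul_assoc _ _ _
      _ ≤ c * t := mul_le_mul_of_nonneg_left h2 hc
  filter_upwards [eventually_one_le_pow_mul (fun n x hx => hpos x hx _ (hpow x hx n)) hsv1 hb,
    eventually_one_le_pow_mul (fun n x hx => hpos _ (hpow x hx n) x hx) hsv2 hb]
    with n h1 h2 f hf x hx
  have hb0 : 0 ≤ b ^ n := by positivity
  exact ⟨hcomb hb0 ENNReal.toReal_nonneg (h1 x hx) (hharn f hf x hx _),
    hcomb hb0 ENNReal.toReal_nonneg (h2 x hx) (hharn f hf _ (hpow x hx n) _)⟩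

end Translation

section Ladder

theorem eq_tsum_iterate_add {α : Type*} {p : α → α → ℝ≥0∞} {f ψ : α → ℝ≥0∞}
    (hf : f = ψ + kapp p f) {x : α} {r : ℝ≥0∞}
    (hr : Tendsto (fun n => (kapp p)^[n] f x) atTop (nhds r)) :
    f x = greenApp p ψ x + r := by
  have hiter : ∀ n, f x = ∑ k ∈ Finset.range n, (kapp p)^[k] ψ x + (kapp p)^[n] f x := by
    intro n
    induction n with
    | zero => simp
    | succ n ih =>
      have h1 : (kapp p)^[n] f x = (kapp p)^[n] ψ x + (kapp p)^[n + 1] f x := by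
        conv_lhs => rw [hf]
        rw [iterate_kapp_add, Pi.add_apply, ← Function.iterate_succ_apply]
      rw [Finset.sum_range_succ, add_assoc, ← h1]
      exact ih
  rw [greenApp_eq_tsum]
  have hlim := (ENNReal.tendsto_nat_tsum fun k => (kapp p)^[k] ψ x).add hr
  exact tendsto_nhds_unique tendsto_const_nhds (hlim.congr fun n => (hiter n).symm)

variable {G : Type*} [Group G] {p : G → G → ℝ≥0∞} {E : Set G} {u : G}

theorem acoef_eq (hp : ∀ x, ∀ y ∉ E, p x y = 0) (u x y : G) :
    acoef p E u x y = p (x * u) y - p x (y * u⁻¹) := by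
  unfold acoef
  split_ifs with h
  · rfl
  · rw [hp x _ h, tsub_zero]

theorem kapp_mul_right (hp : ∀ x, ∀ y ∉ E, p x y = 0) (hu : ∀ x y, p x y ≤ p (x * u) (y * u))
    (f : G → ℝ≥0∞) (x : G) :
    kapp p f (x * u) = Aop p E u f x + kapp p (fun y => f (y * u)) x := by
  have h1 : kapp p (fun y => f (y * u)) x = ∑' y, p x (y * u⁻¹) * f y := by
    rw [← (Equiv.mulRight u).tsum_eq fun y => p x (y * u⁻¹) * f y]
    simp [kapp]
  rw [h1, Aop, ← ENNReal.tsum_add]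
  refine tsum_congr fun y => ?_
  have h2 : p x (y * u⁻¹) ≤ p (x * u) y := by simpa using hu x (y * u⁻¹)
  rw [acoef_eq hp, ← add_mul, tsub_add_cancel_of_le h2]

theorem greenApp_Aop (f : G → ℝ≥0∞) (x : G) :
    greenApp p (Aop p E x f) 1 = kapp (ladder p E) f x := by
  simp only [greenApp, Aop, kapp, ladder, ← ENNReal.tsum_mul_left, ← ENNReal.tsum_mul_right]
  rw [ENNReal.tsum_comm]
  exact tsum_congr fun y => tsum_congr fun z => by ring

theorem ladder_eq_zero (hp : ∀ x, ∀ y ∉ E, p x y = 0) (x : G) : ∀ y ∉ E, ladder p E x y = 0 := by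
  intro y hy
  simp [ladder, acoef_eq hp, hp _ y hy]

theorem eq_add_kapp_ladder_of_translateLim (hp : ∀ x, ∀ y ∉ E, p x y = 0)
    (hu : ∀ x y, p x y ≤ p (x * u) (y * u)) {f : G → ℝ≥0∞} (hf : f ∈ harmonicCone p)
    (hlim : translateLim p u f = f) : f u = f 1 + kapp (ladder p E) f u := by
  have h1 : (fun y => f (y * u)) = Aop p E u f + kapp p fun y => f (y * u) := by
    funext x
    rw [Pi.add_apply, ← kapp_mul_right hp hu, hf.1]
  have h2 := tendsto_atTop_iInf
    fun m n hmn => iterate_kapp_antitone (kapp_translate_le_self hu hf) hmn (1 : G)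
  have h3 : ⨅ n, (kapp p)^[n] (fun y => f (y * u)) 1 = f 1 := congrFun hlim 1
  rw [h3] at h2
  have h4 := eq_tsum_iterate_add h1 h2
  rw [one_mul, greenApp_Aop] at h4
  rw [h4, add_comm]

theorem tendsto_iterate_kapp_of_le {α : Type*} {q : α → α → ℝ≥0∞} {f : α → ℝ≥0∞} {C : ℝ≥0∞}
    (hC : C ≠ ⊤) (hf : ∀ x, f x ≤ C) {x : α} (hx : ∑' n, surv q n x ≠ ⊤) :
    Tendsto (fun n => (kapp q)^[n] f x) atTop (nhds 0) := by
  have h1 : Tendsto (fun n => C * surv q n x) atTop (nhds (C * 0)) :=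
    ENNReal.Tendsto.const_mul (ENNReal.tendsto_atTop_zero_of_tsum_ne_top hx) (Or.inr hC)
  rw [mul_zero] at h1
  refine tendsto_of_tendsto_of_tendsto_of_le_of_le tendsto_const_nhds h1 (fun _ => zero_le) fun n => ?_
  have h2 : f ≤ fun y => C * (1 : α → ℝ≥0∞) y := fun y => by simpa using hf y
  have h3 := iterate_kapp_mono q n h2 x
  rwa [iterate_kapp_const_mul, ← surv_eq_iterate] at h3

theorem gexp_eq_add_kapp_ladder (hp : ∀ x, ∀ y ∉ E, p x y = 0)
    (hu : ∀ x y, p x y ≤ p (x * u) (y * u)) {C : ℝ≥0∞} (hC : C ≠ ⊤) (hg : ∀ x, gexp p x ≤ C) :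
    gexp p u = gexp p 1 + kapp (ladder p E) (gexp p) u := by
  have h1 : (fun y => gexp p (y * u)) =
      (1 + Aop p E u (gexp p)) + kapp p fun y => gexp p (y * u) := by
    funext x
    rw [gexp_eq, kapp_mul_right hp hu, ← add_assoc]
    rfl
  have h2 := eq_tsum_iterate_add h1 (tendsto_iterate_kapp_of_le hC (fun x => hg (x * u))
    (x := 1) (ne_top_of_le_ne_top hC (hg 1)))
  have h3 : greenApp p (1 + Aop p E u (gexp p)) 1 =
      gexp p 1 + greenApp p (Aop p E u (gexp p)) 1 := by
    simp only [greenApp_eq_tsum, iterate_kapp_add, Pi.add_apply, ENNReal.tsum_add, gexp,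
      ← surv_eq_iterate]
  rw [one_mul, add_zero, h3, greenApp_Aop] at h2
  exact h2

theorem one_le_gexp {α : Type*} (p : α → α → ℝ≥0∞) (x : α) : 1 ≤ gexp p x := by
  rw [gexp_eq]
  exact le_self_add

theorem gexp_bounds (hp : ∀ x, ∀ y ∉ E, p x y = 0)
    (hmono : ∀ u ∈ E, ∀ x y, p x y ≤ p (x * u) (y * u)) {C : ℝ≥0∞} (hC : C ≠ ⊤)
    (hg : ∀ x, gexp p x ≤ C) {x : G} (hx : x ∈ E) :
    (∀ n, gexp p 1 * ∑ k ∈ Finset.range n, surv (ladder p E) k x ≤ gexp p x) ∧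
    gexp p x ≤ gexp p 1 * V p E x := by
  have key := fun n => eq_sum_surv_add_iterate (ladder_eq_zero hp)
    (fun y hy => gexp_eq_add_kapp_ladder hp (hmono y hy) hC hg) n x hx
  refine ⟨fun n => ?_, ?_⟩
  · rw [key n]
    exact le_self_add
  · by_cases hV : V p E x = ⊤
    · rw [hV, ENNReal.mul_top (zero_lt_one.trans_le (one_le_gexp p 1)).ne']
      exact le_top
    · have hlim := tendsto_iterate_kapp_of_le hC hg hV
      have h1 := hlim.const_add (gexp p 1 * V p E x)
      rw [add_zero] at h1
      refine ge_of_tendsto' h1 fun n => ?_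
      conv_lhs => rw [key n]
      gcongr
      exact ENNReal.sum_le_tsum _

theorem kiter_mono {α : Type*} {p q : α → α → ℝ≥0∞} (h : p ≤ q) (n : ℕ) :
    kiter p n ≤ kiter q n := by
  induction n with
  | zero => exact le_rfl
  | succ n ih =>
    exact fun x y => kapp_mono h (fun z => ih z y) x

theorem kiter_iSup {α : Type*} {p : ℕ → α → α → ℝ≥0∞} (hp : Monotone p) (k : ℕ) (x y : α) :
    kiter (fun x y => ⨆ n, p n x y) k x y = ⨆ n, kiter (p n) k x y := by
  induction k generalizing x with
  | zero => simp [kiter]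
  | succ k ih =>
    change kapp (fun x y => ⨆ n, p n x y) (fun z => kiter _ k z y) x = _
    simp only [ih]
    exact kapp_iSup hp (fun m n h z => kiter_mono (hp h) k z y) x

theorem green_mono {α : Type*} {p q : α → α → ℝ≥0∞} (h : p ≤ q) : green p ≤ green q :=
  fun x y => ENNReal.tsum_le_tsum fun n => kiter_mono h n x y

theorem green_iSup {α : Type*} {p : ℕ → α → α → ℝ≥0∞} (hp : Monotone p) (x y : α) :
    green (fun x y => ⨆ n, p n x y) x y = ⨆ n, green (p n) x y := by
  simp only [green, kiter_iSup hp]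
  exact tsum_iSup_of_monotone fun m n h k => kiter_mono (hp h) k x y

theorem gexp_iSup {α : Type*} {p : ℕ → α → α → ℝ≥0∞} (hp : Monotone p) (x : α) :
    gexp (fun x y => ⨆ n, p n x y) x = ⨆ n, gexp (p n) x := by
  simp only [gexp, surv_iSup hp]
  exact tsum_iSup_of_monotone fun m n h k => surv_mono (hp h) k x

theorem acoef_const_mul {s : ℝ≥0∞} (hs : s ≠ ⊤) (u x y : G) :
    acoef (fun x y => s * p x y) E u x y = s * acoef p E u x y := by
  unfold acoef
  split_ifs
  · rw [ENNReal.mul_sub fun _ _ => hs]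
  · rfl

theorem surv_const_mul_le {α : Type*} {p : α → α → ℝ≥0∞} (hsub : ∀ x, (∑' y, p x y) ≤ 1)
    (s : ℝ≥0∞) (n : ℕ) (x : α) : surv (fun x y => s * p x y) n x ≤ s ^ n := by
  induction n generalizing x with
  | zero => rw [surv_zero, pow_zero]
  | succ n ih =>
    rw [surv_succ, pow_succ']
    calc kapp (fun x y => s * p x y) (surv (fun x y => s * p x y) n) x
        ≤ ∑' y, s * p x y * s ^ n := ENNReal.tsum_le_tsum fun y => mul_le_mul' le_rfl (ih y)
      _ = s * (∑' y, p x y) * s ^ n := by rw [ENNReal.tsum_mul_right, ENNReal.tsum_mul_left]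
      _ ≤ s * 1 * s ^ n := by gcongr; exact hsub x
      _ = s * s ^ n := by rw [mul_one]

/-- The renewal function is subharmonic when the expected lifetime is infinite. -/
theorem V_le_kapp (hp : ∀ x, ∀ y ∉ E, p x y = 0) (hsub : ∀ x, (∑' y, p x y) ≤ 1)
    (hmono : ∀ u ∈ E, ∀ x y, p x y ≤ p (x * u) (y * u)) (htop : gexp p 1 = ⊤) {x : G}
    (hx : x ∈ E) : V p E x ≤ kapp p (V p E) x := by
  obtain ⟨s, hs_mono, hs_mem, hs_lim⟩ := exists_seq_strictMono_tendsto' (zero_lt_one (α := ℝ≥0∞))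
  have hs_top : ∀ i, s i ≠ ⊤ := fun i => ((hs_mem i).2.trans ENNReal.one_lt_top).ne
  have hs_sup : ⨆ i, s i = 1 :=
    tendsto_nhds_unique (tendsto_atTop_iSup hs_mono.monotone) hs_lim
  set P : ℕ → G → G → ℝ≥0∞ := fun i x y => s i * p x y with hP
  have hPmono : Monotone P := fun i j hij x y => mul_le_mul' (hs_mono.monotone hij) le_rfl
  have hPsup : (fun x y => ⨆ i, P i x y) = p := by
    funext x y
    rw [hP, ← ENNReal.iSup_mul, hs_sup, one_mul]
  have hac : Monotone fun i u x y => acoef (P i) E u x y := by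
    intro i j hij u x y
    simp only [hP, acoef_const_mul (hs_top _)]
    exact mul_le_mul' (hs_mono.monotone hij) le_rfl
  have hqmono : Monotone fun i => ladder (P i) E := by
    intro i j hij x y
    exact ENNReal.tsum_le_tsum fun z =>
      mul_le_mul' (green_mono (hPmono hij) 1 z) (hac hij x z y)
  have hqsup : (fun x y => ⨆ i, ladder (P i) E x y) = ladder p E := by
    funext x y
    have h1 := kapp_iSup (p := fun i (_ : G) z => green (P i) 1 z)
      (f := fun i z => acoef (P i) E x z y)
      (fun i j hij _ z => green_mono (hPmono hij) 1 z) (fun i j hij z => hac hij x z y) 1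
    simp only [kapp] at h1
    simp only [ladder]
    rw [← h1]
    refine tsum_congr fun z => ?_
    rw [← green_iSup hPmono, hPsup]
    simp only [hP, acoef_const_mul (hs_top _)]
    rw [← ENNReal.iSup_mul, hs_sup, one_mul]
  have hbound : ∀ i, ∃ C : ℝ≥0∞, C ≠ ⊤ ∧ ∀ x, gexp (P i) x ≤ C := by
    intro i
    refine ⟨(1 - s i)⁻¹, ENNReal.inv_ne_top.2 (tsub_pos_of_lt (hs_mem i).2).ne', fun x => ?_⟩
    rw [← ENNReal.tsum_geometric]
    exact ENNReal.tsum_le_tsum fun n => surv_const_mul_le hsub (s i) n x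
  have hPle : ∀ i, P i ≤ p := by
    intro i x y
    exact mul_le_of_le_one_left' (hs_mem i).2.le
  have hVle : ∀ i y, V (P i) E y ≤ V p E y := by
    intro i y
    refine ENNReal.tsum_le_tsum fun n => surv_mono ?_ n y
    intro x y
    rw [← hqsup]
    exact le_iSup (fun i => ladder (P i) E x y) i
  have key : ∀ n i, ∑ k ∈ Finset.range n, surv (ladder (P i) E) k x ≤
      (gexp (P i) 1)⁻¹ + kapp p (V p E) x := by
    intro n i
    obtain ⟨C, hC, hg⟩ := hbound i
    have hb := fun y hy => gexp_bounds (p := P i) (E := E) (x := y)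
      (fun x y hy => by simp [hP, hp x y hy])
      (fun u hu x y => mul_le_mul' le_rfl (hmono u hu x y)) hC hg hy
    have h0 : gexp (P i) 1 ≠ 0 := (zero_lt_one.trans_le (one_le_gexp _ 1)).ne'
    have h1 : gexp (P i) 1 ≠ ⊤ := ne_top_of_le_ne_top hC (hg 1)
    have h2 : gexp (P i) x ≤ 1 + gexp (P i) 1 * kapp p (V p E) x := by
      rw [gexp_eq]
      refine add_le_add le_rfl ((kapp_mono (hPle i) le_rfl x).trans ?_)
      refine (kapp_le_of_le_on (hp x) fun y hy => ((hb y hy).2.trans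
        (mul_le_mul' le_rfl (hVle i y)))).trans ?_
      rw [kapp_const_mul]
    have h3 := ((hb x hx).1 n).trans h2
    calc ∑ k ∈ Finset.range n, surv (ladder (P i) E) k x
        = (gexp (P i) 1)⁻¹ * (gexp (P i) 1 *
            ∑ k ∈ Finset.range n, surv (ladder (P i) E) k x) := by
          rw [← mul_assoc, ENNReal.inv_mul_cancel h0 h1, one_mul]
      _ ≤ (gexp (P i) 1)⁻¹ * (1 + gexp (P i) 1 * kapp p (V p E) x) := mul_le_mul' le_rfl h3
      _ = (gexp (P i) 1)⁻¹ + kapp p (V p E) x := by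
          rw [mul_add, mul_one, ← mul_assoc, ENNReal.inv_mul_cancel h0 h1, one_mul]
  have hinv : Tendsto (fun i => (gexp (P i) 1)⁻¹) atTop (nhds 0) := by
    have h1 : Tendsto (fun i => gexp (P i) 1) atTop (nhds (⨆ i, gexp (P i) 1)) :=
      tendsto_atTop_iSup fun i j hij =>
        ENNReal.tsum_le_tsum fun n => surv_mono (hPmono hij) n 1
    rw [← gexp_iSup hPmono, hPsup, htop] at h1
    simpa using tendsto_inv_iff.2 h1
  rw [V, ENNReal.tsum_eq_iSup_nat]
  refine iSup_le fun n => ?_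
  have hl : Tendsto (fun i => ∑ k ∈ Finset.range n, surv (ladder (P i) E) k x) atTop
      (nhds (∑ k ∈ Finset.range n, surv (ladder p E) k x)) := by
    refine tendsto_finsetSum _ fun k _ => ?_
    rw [← hqsup, surv_iSup hqmono]
    exact tendsto_atTop_iSup fun i j hij => surv_mono (hqmono hij) k x
  have hr := hinv.add_const (kapp p (V p E) x)
  rw [zero_add] at hr
  exact le_of_tendsto_of_tendsto' hl hr (key n)

end Ladder

end RW

theorem statement15 {G : Type*} [Group G] [Countable G]
    (p : G → G → ℝ≥0∞) (E : Set G)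
    (hsupp : ∀ x y, p x y ≠ 0 → x ∈ E ∧ y ∈ E)
    (hsub : ∀ x, (∑' y, p x y) ≤ 1)
    (hirr : ∀ x ∈ E, ∀ y ∈ E, 0 < hitProb p x y)
    (htrans : ∀ x ∈ E, green p x x < ⊤)
    (hone : (1 : G) ∈ E)
    (hmul : ∀ x ∈ E, ∀ y ∈ E, x * y ∈ E)
    (hmono : ∀ x ∈ E, ∀ y ∈ E, ∀ u ∈ E, p x y ≤ p (x * u) (y * u))
    (hsv1 : ∀ u ∈ E, TendstoUniformlyOn
      (fun (n : ℕ) (x : G) => Real.log ((hitProb p x (x * u ^ n)).toReal) / n)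
      (fun _ => 0) atTop E)
    (hsv2 : ∀ u ∈ E, TendstoUniformlyOn
      (fun (n : ℕ) (x : G) => Real.log ((hitProb p (x * u ^ n) x).toReal) / n)
      (fun _ => 0) atTop E)
    (h : G → ℝ≥0∞) (hhfin : ∀ x ∈ E, h x ≠ ⊤)
    (hharm : ∀ x ∈ E, kapp p h x = h x) :
    (∀ x ∈ E, h x = h 1 + kapp (ladder p E) h x) ∧
    (∀ x ∈ E, kapp (ladder p E) h x ≤ h x) ∧
    ∃ htilde : G → ℝ≥0∞,
      (∀ x ∈ E, Tendsto (fun n => ∑' y, kiter (ladder p E) n x y * h y)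
        atTop (nhds (htilde x))) ∧
      (∀ x ∈ E, h x = h 1 * V p E x + htilde x) ∧
      (∀ x ∈ E, kapp (ladder p E) htilde x = htilde x) ∧
      ((∀ x ∈ E, gexp p x = ⊤) → ∀ x ∈ E, htilde x = 0 ∧ h x = h 1 * V p E x) := by
  have hp : ∀ x, ∀ y ∉ E, p x y = 0 := fun x y hy => by
    by_contra hne
    exact hy (hsupp x y hne).2
  have hp' : ∀ x ∉ E, ∀ y, p x y = 0 := fun x hx y => by
    by_contra hne
    exact hx (hsupp x y hne).1
  have hmono' : ∀ u ∈ E, ∀ x y, p x y ≤ p (x * u) (y * u) := by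
    intro u hu x y
    by_cases hne : p x y = 0
    · rw [hne]; exact zero_le
    · exact hmono x (hsupp x y hne).1 y (hsupp x y hne).2 u hu
  have hpow : ∀ u ∈ E, ∀ x ∈ E, ∀ n : ℕ, x * u ^ n ∈ E := by
    intro u hu x hx n
    induction n with
    | zero => simpa using hx
    | succ n ih =>
      rw [pow_succ, ← mul_assoc]
      exact hmul _ ih u hu
  have hq := ladder_eq_zero (p := p) (E := E) hp
  have hcone : kapp p h ∈ harmonicCone p := by
    refine ⟨funext fun x => kapp_congr (hp x) hharm, fun x => ?_⟩
    by_cases hx : x ∈ E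
    · rw [hharm x hx]
      exact hhfin x hx
    · simp [kapp, hp' x hx]
  have hfe : ∀ x ∈ E, h x = h 1 + kapp (ladder p E) h x := by
    intro u hu
    have hlim := translateLim_eq_self hp' (hmono' u hu) (fun x hx => hmul x hx u hu)
      (harmonicCone_grow hp hsub hirr (hpow u hu) (hsv1 u hu) (hsv2 u hu)) hcone
    have h1 := eq_add_kapp_ladder_of_translateLim hp (hmono' u hu) hcone hlim
    rwa [hharm u hu, hharm 1 hone, kapp_congr (hq u) hharm] at h1
  have hle : ∀ x ∈ E, kapp (ladder p E) h x ≤ h x := fun x hx =>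
    (hfe x hx).symm ▸ le_add_self
  -- Setting `h` to `⊤` off `E` makes it globally superharmonic for the ladder kernel.
  set g : G → ℝ≥0∞ := fun x => if x ∈ E then h x else ⊤ with hg
  have hgE : ∀ x ∈ E, g x = h x := fun x hx => if_pos hx
  have hkg : kapp (ladder p E) g = kapp (ladder p E) h := funext fun x => kapp_congr (hq x) hgE
  have hgle : kapp (ladder p E) g ≤ g := by
    intro x
    by_cases hx : x ∈ E
    · rw [hkg, hgE x hx]
      exact hle x hx
    · simp [hg, hx]
  have hiter : ∀ n, ∀ x ∈ E, (kapp (ladder p E))^[n] g x = (kapp (ladder p E))^[n] h x := by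
    intro n x hx
    cases n with
    | zero => exact hgE x hx
    | succ n => rw [Function.iterate_succ_apply, Function.iterate_succ_apply, hkg]
  have htend : ∀ x ∈ E, Tendsto (fun n => (kapp (ladder p E))^[n] h x) atTop
      (nhds (⨅ n, (kapp (ladder p E))^[n] g x)) := by
    intro x hx
    exact (tendsto_atTop_iInf fun m n hmn => iterate_kapp_antitone hgle hmn x).congr
      fun n => hiter n x hx
  have hdecomp : ∀ x ∈ E, h x = h 1 * V p E x + ⨅ n, (kapp (ladder p E))^[n] g x := by
    intro x hx
    have h1 := (ENNReal.Tendsto.const_mul (ENNReal.tendsto_nat_tsum fun k => surv (ladder p E) k x)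
      (Or.inr (hhfin 1 hone))).add (htend x hx)
    exact tendsto_nhds_unique tendsto_const_nhds
      (h1.congr fun n => (eq_sum_surv_add_iterate hq hfe n x hx).symm)
  refine ⟨hfe, hle, fun x => ⨅ n, (kapp (ladder p E))^[n] g x, ?_, hdecomp, ?_, ?_⟩
  · intro x hx
    refine (htend x hx).congr fun n => ?_
    rw [← kapp_kiter]
    rfl
  · intro x hx
    refine kapp_iInf_iterate hgle ?_
    rw [hkg]
    exact ne_top_of_le_ne_top (hhfin x hx) (hle x hx)
  · intro htop
    set k : G → ℝ≥0∞ := fun x => ⨅ n, (kapp (ladder p E))^[n] g x with hk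
    have hkh : ∀ x ∈ E, h x = h 1 * V p E x + k x := hdecomp
    have hVfin : ∀ x ∈ E, h 1 * V p E x ≠ ⊤ := fun x hx =>
      ne_top_of_le_ne_top (hhfin x hx) ((hkh x hx).symm ▸ le_self_add)
    have hsuper : ∀ x ∈ E, kapp p k x ≤ k x := by
      intro x hx
      have h1 : h 1 * kapp p (V p E) x + kapp p k x = h 1 * V p E x + k x := by
        rw [← hkh x hx, ← hharm x hx, kapp_congr (hp x) hkh]
        have := congrFun (kapp_add p (fun y => h 1 * V p E y) k) x
        rw [kapp_const_mul] at this
        exact this.symm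
      have h2 : h 1 * V p E x ≤ h 1 * kapp p (V p E) x :=
        mul_le_mul' le_rfl (V_le_kapp hp hsub hmono' (htop 1 hone) hx)
      refine (ENNReal.add_le_add_iff_left (hVfin x hx)).1 ?_
      exact (add_le_add h2 le_rfl).trans h1.le
    have hV1 : 1 ≤ V p E 1 := one_le_gexp (ladder p E) 1
    have hk1 : k 1 = 0 := by
      have h1 := hkh 1 hone
      have h2 : h 1 + k 1 ≤ h 1 + 0 := by
        rw [add_zero]
        calc h 1 + k 1 ≤ h 1 * V p E 1 + k 1 :=
              add_le_add (le_mul_of_one_le_right' hV1) le_rfl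
          _ = h 1 := h1.symm
      exact nonpos_iff_eq_zero.1 ((ENNReal.add_le_add_iff_left (hhfin 1 hone)).1 h2)
    intro x hx
    have hk0 : k x = 0 := by
      have h1 := hitProb_mul_le hp hsuper hone x
      rw [hk1, nonpos_iff_eq_zero, mul_eq_zero] at h1
      exact h1.resolve_left (hirr 1 hone x hx).ne'
    refine ⟨hk0, ?_⟩
    have h1 := hkh x hx
    rwa [hk0, add_zero] at h1
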